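/- In any tiling ℤ_{144} = A ⊕ B with |A| = 16 and |B| = 9, either A or B is periodic. -/

import Mathlib

open Polynomial

/-- The mask polynomial `∑ a ∈ S, X ^ a` of a set of residues. -/
noncomputable def maskPoly (R : Type*) [CommRing R] {n : ℕ} (S : Finset (ZMod n)) : R[X] :=
  ∑ a ∈ S, X ^ a.val

lemma map_maskPoly {n : ℕ} (S : Finset (ZMod n)) :
    (maskPoly ℤ S).map (Int.castRingHom ℚ) = maskPoly ℚ S := by
  simp [maskPoly, Polynomial.map_sum]

lemma eval_one_maskPoly {n : ℕ} (S : Finset (ZMod n)) : (maskPoly ℤ S).eval 1 = S.card := by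
  simp [maskPoly, eval_finsetSum]

/-- A prime-power cyclotomic polynomial contributes its prime to the cardinality. -/
lemma prime_dvd_card_of_cyclotomic_dvd {n p k : ℕ} (hp : p.Prime) {S : Finset (ZMod n)}
    (h : cyclotomic (p ^ (k + 1)) ℤ ∣ maskPoly ℤ S) : p ∣ S.card := by
  have := Fact.mk hp
  have h1 := eval_dvd (x := 1) h
  rw [eval_one_cyclotomic_prime_pow, eval_one_maskPoly] at h1
  exact_mod_cast h1

lemma X_pow_sub_one_dvd_of_cyclotomic_dvd {n : ℕ} (hn : 0 < n) {P : ℚ[X]}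
    (h : ∀ d ∈ n.divisors, cyclotomic d ℚ ∣ P) : X ^ n - 1 ∣ P := by
  rw [← prod_cyclotomic_eq_X_pow_sub_one hn]
  exact Finset.prod_dvd_of_coprime
    (fun _ _ _ _ hij => cyclotomic.isCoprime_rat hij) h

/-- The reduction of polynomials to the group algebra of `ℤ/n`. -/
noncomputable def toGroupAlgebra (n : ℕ) : ℚ[X] →ₐ[ℚ] AddMonoidAlgebra ℚ (ZMod n) :=
  aeval (AddMonoidAlgebra.single 1 1)

lemma toGroupAlgebra_X_pow (n k : ℕ) :
    toGroupAlgebra n (X ^ k) = AddMonoidAlgebra.single (k : ZMod n) 1 := by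
  simp [toGroupAlgebra, AddMonoidAlgebra.single_pow]

lemma toGroupAlgebra_eq_zero_of_dvd {n : ℕ} {P : ℚ[X]} (h : X ^ n - 1 ∣ P) :
    toGroupAlgebra n P = 0 := by
  obtain ⟨Q, rfl⟩ := h
  rw [map_mul, map_sub, toGroupAlgebra_X_pow, map_one, ZMod.natCast_self,
    ← AddMonoidAlgebra.one_def, sub_self, zero_mul]

lemma coeff_toGroupAlgebra_X_pow_mul_maskPoly {n : ℕ} (m k : ℕ) (S : Finset (ZMod n))
    (r : ZMod m) :
    (toGroupAlgebra m (X ^ k * maskPoly ℚ S)).coeff r =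
      ((S.filter fun a => ((a.val : ℕ) : ZMod m) = r - k).card : ℚ) := by
  simp only [maskPoly, Finset.mul_sum, ← pow_add, map_sum, toGroupAlgebra_X_pow,
    AddMonoidAlgebra.coeff_sum, AddMonoidAlgebra.coeff_single, Finsupp.finsetSum_apply]
  rw [Finset.card_filter]
  push_cast
  refine Finset.sum_congr rfl fun a _ => ?_
  rw [Finsupp.single_apply]
  simp only [eq_sub_iff_add_eq, add_comm]

lemma coeff_toGroupAlgebra_self {n : ℕ} [NeZero n] (k : ℕ) (S : Finset (ZMod n))
    (r : ZMod n) :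
    (toGroupAlgebra n (X ^ k * maskPoly ℚ S)).coeff r = if r - k ∈ S then 1 else 0 := by
  rw [coeff_toGroupAlgebra_X_pow_mul_maskPoly]
  simp only [ZMod.natCast_zmod_val, Finset.filter_eq']
  split_ifs <;> simp

/-- A set of `m` residues whose mask polynomial is divisible by `(X ^ m - 1) / (X - 1)` consists
of pairwise incongruent residues modulo `m`. -/
lemma eq_of_cast_eq_of_cyclotomic_dvd {n m : ℕ} [NeZero m] {S : Finset (ZMod n)}
    (hcard : S.card = m) (h : ∀ d ∈ m.divisors, d ≠ 1 → cyclotomic d ℚ ∣ maskPoly ℚ S)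
    {a b : ZMod n} (ha : a ∈ S) (hb : b ∈ S) (hab : (a.val : ZMod m) = b.val) : a = b := by
  set c : ZMod m → ℕ := fun r => (S.filter fun a => ((a.val : ℕ) : ZMod m) = r).card with hc
  have hdvd : (X : ℚ[X]) ^ m - 1 ∣ X ^ 1 * maskPoly ℚ S - X ^ 0 * maskPoly ℚ S := by
    have hfactor : X ^ 1 * maskPoly ℚ S - X ^ 0 * maskPoly ℚ S =
        cyclotomic 1 ℚ * maskPoly ℚ S := by
      rw [cyclotomic_one]; ring
    rw [hfactor]
    refine X_pow_sub_one_dvd_of_cyclotomic_dvd (NeZero.pos m) fun d hd => ?_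
    by_cases h1 : d = 1
    · exact h1 ▸ dvd_mul_right _ _
    · exact (h d hd h1).mul_left _
  have hstep (r : ZMod m) : c (r - 1) = c r := by
    have h0 := congrArg (fun x => x.coeff r) (toGroupAlgebra_eq_zero_of_dvd hdvd)
    simp only [map_sub, AddMonoidAlgebra.coeff_sub, Finsupp.sub_apply,
      coeff_toGroupAlgebra_X_pow_mul_maskPoly, AddMonoidAlgebra.coeff_zero,
      Finsupp.zero_apply, sub_eq_zero] at h0
    simpa [hc] using h0
  have hconst (k : ℕ) : c k = c 0 := by
    induction k with
    | zero => simp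
    | succ k ih => rw [← ih, ← hstep]; simp
  have hconst' (r : ZMod m) : c r = c 0 := by
    rw [← hconst r.val, ZMod.natCast_zmod_val]
  have hsum : ∑ r, c r = m := by
    refine Eq.trans ?_ hcard
    exact (Finset.card_eq_sum_card_fiberwise fun _ _ => Finset.mem_coe.2 (Finset.mem_univ _)).symm
  have h0 : c 0 = 1 := by
    simp only [hconst', Finset.sum_const, Finset.card_univ, ZMod.card, smul_eq_mul] at hsum
    exact Nat.eq_of_mul_eq_mul_left (NeZero.pos m) (by rw [hsum, mul_one])
  have h1 : c (b.val : ZMod m) ≤ 1 := (hconst' _).trans h0 |>.le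
  exact Finset.card_le_one.1 h1 a (by simp [ha, hab]) b (by simp [hb])

/-- For each divisor `d ≠ 1` of `n`, the `d`-th cyclotomic polynomial divides the mask polynomial
of one of the two tiles of `ℤ/n`. -/
lemma cyclotomic_dvd_maskPoly_of_tiling {n : ℕ} [NeZero n] {A B : Finset (ZMod n)}
    (htile : ∀ g : ZMod n, ∃! p : ZMod n × ZMod n, p.1 ∈ A ∧ p.2 ∈ B ∧ p.1 + p.2 = g)
    {d : ℕ} (hd : d ∣ n) (hd1 : d ≠ 1) :
    cyclotomic d ℤ ∣ maskPoly ℤ A ∨ cyclotomic d ℤ ∣ maskPoly ℤ B := by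
  have hd0 : d ≠ 0 := fun h => NeZero.ne n (Nat.eq_zero_of_zero_dvd (h ▸ hd))
  have hζ := Complex.isPrimitiveRoot_exp d hd0
  set ζ := Complex.exp (2 * Real.pi * Complex.I / d)
  have hζn : ζ ^ n = 1 := (hζ.pow_eq_one_iff_dvd n).2 hd
  have hdvd (S : Finset (ZMod n)) (hS : ∑ a ∈ S, ζ ^ a.val = 0) :
      cyclotomic d ℤ ∣ maskPoly ℤ S := by
    rw [cyclotomic_eq_minpoly hζ (Nat.pos_of_ne_zero hd0)]
    refine minpoly.isIntegrallyClosed_dvd (hζ.isIntegral (Nat.pos_of_ne_zero hd0)) ?_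
    simpa [maskPoly] using hS
  have hprod : (∑ a ∈ A, ζ ^ a.val) * ∑ b ∈ B, ζ ^ b.val = ∑ g : ZMod n, ζ ^ g.val := by
    rw [Finset.sum_mul_sum, ← Finset.sum_product']
    refine Finset.sum_bij (fun p _ => p.1 + p.2) (fun _ _ => Finset.mem_univ _) ?_ ?_ ?_
    · intro p hp q hq hpq
      rw [Finset.mem_product] at hp hq
      exact (htile (q.1 + q.2)).unique ⟨hp.1, hp.2, hpq⟩ ⟨hq.1, hq.2, rfl⟩
    · intro g _
      obtain ⟨p, ⟨hA, hB, hp⟩, -⟩ := htile g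
      exact ⟨p, Finset.mem_product.2 ⟨hA, hB⟩, hp⟩
    · intro p _
      rw [ZMod.val_add, ← pow_eq_pow_mod _ hζn, pow_add]
  have hzero : ∑ g : ZMod n, ζ ^ g.val = 0 := by
    have hζ1 : ζ ≠ 1 := hζ.ne_one (by omega)
    refine (mul_eq_zero.1 ?_).resolve_left (sub_ne_zero.2 hζ1)
    rw [sub_mul, one_mul, Finset.mul_sum, sub_eq_zero]
    refine Fintype.sum_equiv (Equiv.addRight 1) _ _ fun g => ?_
    rw [Equiv.coe_addRight, ZMod.val_add, ← pow_eq_pow_mod _ hζn, pow_add, mul_comm,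
      ZMod.val_one_eq_one_mod, ← pow_eq_pow_mod _ hζn, pow_one]
  rw [hzero, mul_eq_zero] at hprod
  exact hprod.imp (hdvd A) (hdvd B)

lemma cyclotomic_dvd_maskPoly_rat {n d : ℕ} {S : Finset (ZMod n)}
    (h : cyclotomic d ℤ ∣ maskPoly ℤ S) : cyclotomic d ℚ ∣ maskPoly ℚ S := by
  rw [← map_maskPoly, ← map_cyclotomic_int]
  exact Polynomial.map_dvd _ h

/-- The linear relation between indicator values of a set of residues modulo `144` that expresses
the vanishing of its mask polynomial at the primitive `144`-th roots of unity. -/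
lemma indicator_relation_of_cyclotomic_dvd {S : Finset (ZMod 144)}
    (h : cyclotomic 144 ℚ ∣ maskPoly ℚ S) (r : ZMod 144) :
    (if r - 120 ∈ S then 1 else 0) + (if r ∈ S then 1 else 0) =
      (if r - 72 ∈ S then 1 else 0) + (if r - 48 ∈ S then (1 : ℚ) else 0) := by
  have hdvd : (X : ℚ[X]) ^ 144 - 1 ∣ X ^ 120 * maskPoly ℚ S + X ^ 0 * maskPoly ℚ S -
      (X ^ 72 * maskPoly ℚ S + X ^ 48 * maskPoly ℚ S) := by
    have hfactor : X ^ 120 * maskPoly ℚ S + X ^ 0 * maskPoly ℚ S -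
        (X ^ 72 * maskPoly ℚ S + X ^ 48 * maskPoly ℚ S) =
        (X ^ 72 - 1) * (X ^ 48 - 1) * maskPoly ℚ S := by ring
    rw [hfactor]
    refine X_pow_sub_one_dvd_of_cyclotomic_dvd (by norm_num) fun d hd => ?_
    have hcases : d ∣ 72 ∨ d ∣ 48 ∨ d = 144 := by
      revert d; decide +kernel
    have hdiv {k : ℕ} (hk : d ∣ k) : cyclotomic d ℚ ∣ X ^ k - 1 :=
      (cyclotomic.dvd_X_pow_sub_one d ℚ).trans (by
        obtain ⟨j, rfl⟩ := hk
        exact pow_one_sub_dvd_pow_mul_sub_one X d j)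
    rcases hcases with hd | hd | rfl
    · exact ((hdiv hd).mul_right _).mul_right _
    · exact ((hdiv hd).mul_left _).mul_right _
    · exact h.mul_left _
  have h0 := congrArg (fun x => x.coeff r) (toGroupAlgebra_eq_zero_of_dvd hdvd)
  simp only [map_sub, map_add, AddMonoidAlgebra.coeff_sub, AddMonoidAlgebra.coeff_add,
    Finsupp.sub_apply, Finsupp.add_apply, coeff_toGroupAlgebra_self,
    AddMonoidAlgebra.coeff_zero, Finsupp.zero_apply, sub_eq_zero] at h0
  simpa using h0

/-- A translation that maps a finite set into itself fixes it. -/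
lemma image_add_right_eq_of_forall_mem {G : Type*} [AddGroup G] [DecidableEq G] {S : Finset G}
    {g : G} (h : ∀ r ∈ S, r + g ∈ S) : S.image (· + g) = S :=
  Finset.eq_of_subset_of_card_le (Finset.image_subset_iff.2 h)
    (Finset.card_image_of_injective _ (add_left_injective g)).ge

/-- In any tiling `ℤ_{144} = A ⊕ B` with `|A| = 16` and `|B| = 9`, either `A` or `B` is
periodic. -/
theorem stmt_19 (A B : Finset (ZMod 144))
    (htile : ∀ g : ZMod 144, ∃! p : ZMod 144 × ZMod 144, p.1 ∈ A ∧ p.2 ∈ B ∧ p.1 + p.2 = g)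
    (hA : A.card = 16) (hB : B.card = 9) :
    (∃ g : ZMod 144, g ≠ 0 ∧ A.image (· + g) = A) ∨
    (∃ g : ZMod 144, g ≠ 0 ∧ B.image (· + g) = B) := by
  have hAdvd : ∀ d ∈ (16 : ℕ).divisors, d ≠ 1 → cyclotomic d ℚ ∣ maskPoly ℚ A := by
    intro d hd hd1
    obtain ⟨k, -, rfl⟩ := (Nat.mem_divisors_prime_pow Nat.prime_two 4).1 hd
    obtain ⟨k, rfl⟩ := Nat.exists_eq_succ_of_ne_zero (n := k) (by rintro rfl; simp at hd1)
    have hdvd : 2 ^ (k + 1) ∣ 144 := (Nat.dvd_of_mem_divisors hd).trans (by norm_num)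
    refine cyclotomic_dvd_maskPoly_rat
      ((cyclotomic_dvd_maskPoly_of_tiling htile hdvd hd1).resolve_right fun h => ?_)
    have := prime_dvd_card_of_cyclotomic_dvd Nat.prime_two h
    omega
  have hBdvd : ∀ d ∈ (9 : ℕ).divisors, d ≠ 1 → cyclotomic d ℚ ∣ maskPoly ℚ B := by
    intro d hd hd1
    obtain ⟨k, -, rfl⟩ := (Nat.mem_divisors_prime_pow Nat.prime_three 2).1 hd
    obtain ⟨k, rfl⟩ := Nat.exists_eq_succ_of_ne_zero (n := k) (by rintro rfl; simp at hd1)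
    have hdvd : 3 ^ (k + 1) ∣ 144 := (Nat.dvd_of_mem_divisors hd).trans (by norm_num)
    refine cyclotomic_dvd_maskPoly_rat
      ((cyclotomic_dvd_maskPoly_of_tiling htile hdvd hd1).resolve_left fun h => ?_)
    have := prime_dvd_card_of_cyclotomic_dvd Nat.prime_three h
    omega
  rcases cyclotomic_dvd_maskPoly_of_tiling htile dvd_rfl (by norm_num) with h | h
  · refine Or.inl ⟨72, by decide, image_add_right_eq_of_forall_mem fun r hr => ?_⟩
    have hrel := indicator_relation_of_cyclotomic_dvd (cyclotomic_dvd_maskPoly_rat h) r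
    have hcast : ∀ r : ZMod 144, ((r - 48).val : ZMod 16) = r.val := by decide +kernel
    have h48 : r - 48 ∉ A := fun h' => (sub_eq_self (a := r)).not.2 (by decide)
      (eq_of_cast_eq_of_cyclotomic_dvd hA hAdvd h' hr (hcast r))
    have h72 : r - 72 = r + 72 := by rw [sub_eq_add_neg]; rfl
    by_contra hn
    rw [h72, if_pos hr, if_neg h48, if_neg hn] at hrel
    split_ifs at hrel <;> norm_num at hrel
  · refine Or.inr ⟨96, by decide, image_add_right_eq_of_forall_mem fun r hr => ?_⟩
    have hrel := indicator_relation_of_cyclotomic_dvd (cyclotomic_dvd_maskPoly_rat h) r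
    have hcast : ∀ r : ZMod 144, ((r - 72).val : ZMod 9) = r.val := by decide +kernel
    have h72 : r - 72 ∉ B := fun h' => (sub_eq_self (a := r)).not.2 (by decide)
      (eq_of_cast_eq_of_cyclotomic_dvd hB hBdvd h' hr (hcast r))
    have h48 : r - 48 = r + 96 := by rw [sub_eq_add_neg]; rfl
    by_contra hn
    rw [h48, if_pos hr, if_neg h72, if_neg hn] at hrel
    split_ifs at hrel <;> norm_num at hrel
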